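/- Let T be the random tree generated by a weakly irreducible, critical multitype Galton-Watson tree whose offspring sizes have finite second moment, and let S = {n ∈ ℕ : P{|T| = n} > 0} be infinite. Then lim_{n→∞, n∈S} (1/n) log P{|T| = n} = 0. -/

import Mathlib

open scoped ENNReal NNReal BigOperators
open Filter

/-- Finite rooted planar trees with vertex types in `𝒳`. -/
inductive PTree (𝒳 : Type*) where
  | node : 𝒳 → List (PTree 𝒳) → PTree 𝒳

namespace PTree

variable {𝒳 : Type*}

/-- The type of the root. -/
def root : PTree 𝒳 → 𝒳
  | node a _ => a

/-- The list of subtrees rooted at the children of the root (left to right). -/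
def children : PTree 𝒳 → List (PTree 𝒳)
  | node _ ts => ts

/-- The types of the children of the root, from left to right. -/
def childLabels (t : PTree 𝒳) : List 𝒳 := t.children.map root

/-- The list of all subtrees `X^v`, `v` a vertex of the tree. -/
def subtrees : PTree 𝒳 → List (PTree 𝒳)
  | node a ts => node a ts :: (ts.attach.map (fun s => subtrees s.1)).flatten
decreasing_by
  have := List.sizeOf_lt_of_mem s.2
  simp only [PTree.node.sizeOf_spec]
  omega

/-- Number of vertices. -/
def size (t : PTree 𝒳) : ℕ := t.subtrees.length

/-- The vertices at depth exactly `k`, as subtrees, from left to right. -/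
def atDepth : ℕ → PTree 𝒳 → List (PTree 𝒳)
  | 0, t => [t]
  | (k+1), node _ ts => (ts.attach.map (fun s => atDepth k s.1)).flatten

/-- Truncation of a tree at height `k` (keeping the generations `0,…,k`). -/
def trunc : ℕ → PTree 𝒳 → PTree 𝒳
  | 0, node a _ => node a []
  | (k+1), node a ts => node a (ts.attach.map (fun s => trunc k s.1))

/-- The height of a tree (largest `k` such that generation `k` is nonempty). -/
def height : PTree 𝒳 → ℕ
  | node _ [] => 0
  | node _ (t :: ts) => ((t :: ts).attach.map (fun s => height s.1)).foldr max 0 + 1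
decreasing_by
  have := List.sizeOf_lt_of_mem s.2
  simp only [PTree.node.sizeOf_spec] at *
  omega

/-- The largest offspring number in the tree. -/
def maxDeg : PTree 𝒳 → ℕ
  | node _ ts => max ts.length (((ts.attach.map (fun s => maxDeg s.1)).foldr max 0))
decreasing_by
  have := List.sizeOf_lt_of_mem s.2
  simp only [PTree.node.sizeOf_spec] at *
  omega

end PTree
noncomputable instance {𝒳 : Type*} : DecidableEq (PTree 𝒳) := Classical.decEq _

/-- Extended-real logarithm of an extended nonnegative real. -/
noncomputable def elog (x : ℝ≥0∞) : EReal :=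
  if x = 0 then ⊥ else if x = ∞ then ⊤ else ((Real.log x.toReal : ℝ) : EReal)

open Classical in
/-- Relative entropy `H(ν ‖ ρ)` of two (probability) vectors on a countable set,
with value `∞` if `ν` is not absolutely continuous with respect to `ρ`.  (For
probability vectors each summand below is nonnegative and the sum equals
`∑ ν a log (ν a / ρ a)`.) -/
noncomputable def relEnt {α : Type*} (ν ρ : α → ℝ) : ℝ≥0∞ :=
  if ∀ a, ρ a = 0 → ν a = 0 then
    ∑' a, ENNReal.ofReal (ν a * Real.log (ν a / ρ a) + ρ a - ν a)
  else ∞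

/-- The Cramér rate function `I_p(x) = sup_λ {λx - log ∑ p(n) e^{λn}}`. -/
noncomputable def cramerRate (p : ℕ → ℝ) (x : ℝ) : EReal :=
  ⨆ lam : ℝ, ((lam * x - Real.log (∑' n : ℕ, p n * Real.exp (lam * n)) : ℝ) : EReal)

/-- Total mass `P{|T| = n}` assigned by the weight `w` to trees with `n` vertices. -/
noncomputable def treeMass {𝒳 : Type*} (w : PTree 𝒳 → ℝ) (n : ℕ) : ℝ≥0∞ :=
  ∑' t : PTree 𝒳, if t.size = n then ENNReal.ofReal (w t) else 0

open Classical in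
/-- Conditional probability of the event `E` given `{|T| = n}`, for the (sub)probability
weight `w` on finite planar trees.  -/
noncomputable def condP {𝒳 : Type*} (w : PTree 𝒳 → ℝ) (n : ℕ) (E : Set (PTree 𝒳)) : ℝ≥0∞ :=
  (∑' t : PTree 𝒳, if t.size = n ∧ t ∈ E then ENNReal.ofReal (w t) else 0) / treeMass w n

/-- The set of sizes having positive probability. -/
noncomputable def sizeSupport {𝒳 : Type*} (w : PTree 𝒳 → ℝ) : Set ℕ := {n | 0 < treeMass w n}
section Multitype

variable {𝒳 : Type*} [Fintype 𝒳] [DecidableEq 𝒳]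

/-- The weight of a typed tree under the multitype Galton-Watson law with initial
distribution `μ0` and offspring kernel `𝒬` (an offspring `c ∈ 𝒳*` is recorded as the
list of types of the children from left to right):
`μ0(root) ∏_v 𝒬{C(v) | type v}`. -/
noncomputable def mgwWeight (μ0 : 𝒳 → ℝ) (𝒬 : 𝒳 → List 𝒳 → ℝ) (t : PTree 𝒳) : ℝ :=
  μ0 t.root * (t.subtrees.map (fun s => 𝒬 s.root s.childLabels)).prod

/-- The multiplicity `m(a,c)` of the symbol `a` in `c ∈ 𝒳*`. -/
def mult (a : 𝒳) (c : List 𝒳) : ℕ := c.count a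

/-- The empirical offspring measure `M_X` of a typed tree. -/
noncomputable def empOff (t : PTree 𝒳) : 𝒳 × List 𝒳 → ℝ := fun x =>
  ((t.subtrees.filter (fun s => s.root = x.1 ∧ s.childLabels = x.2)).length : ℝ) / t.size

/-- The `𝒳`-marginal `ν₁` of a measure on `𝒳 × 𝒳*`. -/
noncomputable def marg1 (ν : 𝒳 × List 𝒳 → ℝ) (a : 𝒳) : ℝ := ∑' c : List 𝒳, ν (a, c)

/-- Shift-invariance: `ν₁(a) = ∑_{(b,c)} m(a,c) ν(b,c)` for all `a`. -/
def ShiftInv (ν : 𝒳 × List 𝒳 → ℝ) : Prop :=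
  ∀ a : 𝒳, marg1 ν a = ∑' x : 𝒳 × List 𝒳, (mult a x.2 : ℝ) * ν x

/-- Membership in `ℳ(𝒳 × 𝒳*)`: a probability measure with finite mean offspring
number. -/
structure IsOffMeasure (ν : 𝒳 × List 𝒳 → ℝ) : Prop where
  nonneg : ∀ x, 0 ≤ ν x
  hasSum : HasSum ν 1
  moment : Summable (fun x : 𝒳 × List 𝒳 => (x.2.length : ℝ) * ν x)

/-- The space `ℳ(𝒳 × 𝒳*)`. -/
def MSpace (𝒳 : Type*) [Fintype 𝒳] [DecidableEq 𝒳] :=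
  {ν : 𝒳 × List 𝒳 → ℝ // IsOffMeasure ν}

/-- The test functions defining the topology of `ℳ(𝒳 × 𝒳*)`: all bounded functions
together with the functions `(b,c) ↦ m(a,c) 𝟙_{b₀}(b)`, `a, b₀ ∈ 𝒳`. -/
def offTests (𝒳 : Type*) [Fintype 𝒳] [DecidableEq 𝒳] : Set ((𝒳 × List 𝒳) → ℝ) :=
  {f | ∃ M : ℝ, ∀ x, |f x| ≤ M} ∪
    {f | ∃ a b₀ : 𝒳, f = fun x => (mult a x.2 : ℝ) * (if x.1 = b₀ then 1 else 0)}

/-- The topology of `ℳ(𝒳 × 𝒳*)`: the smallest topology making `ν ↦ ∫ f dν`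
continuous for every test function `f`. -/
noncomputable instance : TopologicalSpace (MSpace 𝒳) :=
  TopologicalSpace.induced
    (fun ν : MSpace 𝒳 => fun f : offTests 𝒳 => ∑' x, ν.1 x * f.1 x) Pi.topologicalSpace

open Classical in
/-- The rate function `J(ν) = H(ν ‖ ν₁ ⊗ 𝒬)` for shift-invariant `ν`, `∞` otherwise. -/
noncomputable def offRate (𝒬 : 𝒳 → List 𝒳 → ℝ) (ν : 𝒳 × List 𝒳 → ℝ) : ℝ≥0∞ :=
  if ShiftInv ν then relEnt ν (fun x => marg1 ν x.1 * 𝒬 x.1 x.2) else ∞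

/-- The expected offspring matrix `A(a,b) = ∑_c 𝒬{c | b} m(a,c)` (with values in
`[0,∞]`). -/
noncomputable def meanMat (𝒬 : 𝒳 → List 𝒳 → ℝ) : Matrix 𝒳 𝒳 ℝ≥0∞ :=
  Matrix.of fun a b => ∑' c : List 𝒳, ENNReal.ofReal (𝒬 b c) * (mult a c : ℝ≥0∞)

/-- `A* = ∑_{k ≥ 1} A^k`. -/
noncomputable def matStar (A : Matrix 𝒳 𝒳 ℝ≥0∞) : Matrix 𝒳 𝒳 ℝ≥0∞ :=
  Matrix.of fun a b => ∑' k : ℕ, (A ^ (k + 1)) a b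

/-- Weak irreducibility of a nonnegative matrix with respect to a partition of `𝒳`
into recurrent states `Xr` and transient states `Xt`. -/
structure WeaklyIrred (A : Matrix 𝒳 𝒳 ℝ≥0∞) (Xr Xt : Finset 𝒳) : Prop where
  compl : ∀ a, a ∈ Xr ↔ a ∉ Xt
  npty : Xr.Nonempty
  rec_pos : ∀ a b, b ∈ Xr → 0 < matStar A a b
  trans_zero : ∀ a b, b ∈ Xt → a = b ∨ a ∈ Xr → matStar A a b = 0

/-- The real expected offspring matrix. -/
noncomputable def meanMatR (𝒬 : 𝒳 → List 𝒳 → ℝ) : Matrix 𝒳 𝒳 ℝ :=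
  Matrix.of fun a b => ∑' c : List 𝒳, 𝒬 b c * (mult a c : ℝ)

/-- Criticality: the Perron-Frobenius eigenvalue of the expected offspring matrix is
`1`; equivalently (for weakly irreducible matrices) there is a strictly positive right
eigenvector with eigenvalue `1`. -/
def CriticalKernel (𝒬 : 𝒳 → List 𝒳 → ℝ) : Prop :=
  ∃ u : 𝒳 → ℝ, (∀ a, 0 < u a) ∧ ∀ a, ∑ b, meanMatR 𝒬 a b * u b = u a

/-- The uniform bound on the number of transient offspring. -/
def BoundedTransient (𝒬 : 𝒳 → List 𝒳 → ℝ) (Xt : Finset 𝒳) : Prop :=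
  ∃ B : ℕ, ∀ b c, 𝒬 b c ≠ 0 → c.countP (fun a => decide (a ∈ Xt)) ≤ B

end Multitype
namespace PTree

variable {𝒳 : Type*}

theorem subtrees_node (a : 𝒳) (ts : List (PTree 𝒳)) :
    (node a ts).subtrees = node a ts :: (ts.map subtrees).flatten := by
  rw [subtrees, List.attach_map_val]

theorem size_node (a : 𝒳) (ts : List (PTree 𝒳)) :
    (node a ts).size = (ts.map size).sum + 1 := by
  simp only [size, subtrees_node, List.length_cons, List.length_flatten, List.map_map]
  rfl

/-- A typed tree is a root type together with the list of its subtrees. -/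
def equivNode (𝒳 : Type*) : 𝒳 × List (PTree 𝒳) ≃ PTree 𝒳 where
  toFun x := node x.1 x.2
  invFun t := (t.root, t.children)
  left_inv _ := rfl
  right_inv t := by cases t; rfl

/-- The product of the offspring probabilities over all vertices of the tree. -/
noncomputable def offspringProd (𝒬 : 𝒳 → List 𝒳 → ℝ) (t : PTree 𝒳) : ℝ≥0∞ :=
  (t.subtrees.map (fun s => ENNReal.ofReal (𝒬 s.root s.childLabels))).prod

theorem offspringProd_node (𝒬 : 𝒳 → List 𝒳 → ℝ) (a : 𝒳) (ts : List (PTree 𝒳)) :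
    (node a ts).offspringProd 𝒬 =
      ENNReal.ofReal (𝒬 a (ts.map root)) * (ts.map (offspringProd 𝒬)).prod := by
  simp only [offspringProd, subtrees_node, List.map_cons, List.prod_cons, List.map_flatten,
    List.prod_flatten, List.map_map]
  rfl

end PTree

section GeneratingFunctions

open PTree PowerSeries

variable {𝒳 : Type*}

open Classical in
/-- The generating function of the total progeny of a Galton-Watson tree started from type `a`. -/
noncomputable def progenyGF (𝒬 : 𝒳 → List 𝒳 → ℝ) (a : 𝒳) : PowerSeries ℝ≥0∞ :=
  PowerSeries.mk fun n => ∑' t : PTree 𝒳, if t.root = a ∧ t.size = n then t.offspringProd 𝒬 else 0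

theorem tsum_list_eq_tsum_cons {α : Type*} (f : List α → ℝ≥0∞) (h : f [] = 0) :
    ∑' l, f l = ∑' a, ∑' l, f (a :: l) := by
  rw [← ENNReal.tsum_prod (f := fun a l => f (a :: l))]
  refine (Function.Injective.tsum_eq (g := fun x : α × List α => x.1 :: x.2) ?_ ?_).symm
  · rintro ⟨a, l⟩ ⟨b, m⟩ hh
    simpa using hh
  · intro l hl
    cases l with
    | nil => exact absurd h hl
    | cons a l => exact ⟨(a, l), rfl⟩

open Classical in
theorem coeff_prod_progenyGF (𝒬 : 𝒳 → List 𝒳 → ℝ) (c : List 𝒳) (n : ℕ) :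
    coeff n (c.map (progenyGF 𝒬)).prod = ∑' ts : List (PTree 𝒳),
      if ts.map root = c ∧ (ts.map size).sum = n then (ts.map (offspringProd 𝒬)).prod else 0 := by
  induction c generalizing n with
  | nil =>
    rw [tsum_eq_single []]
    · simp [coeff_one, eq_comm]
    · intro ts hts
      simp [hts]
  | cons x c ih =>
    rw [tsum_list_eq_tsum_cons _ (by simp)]
    simp only [List.map_cons, List.prod_cons, coeff_mul, ih]
    simp only [progenyGF, coeff_mk]
    simp_rw [← ENNReal.tsum_mul_right, ← ENNReal.tsum_mul_left]
    rw [← Summable.tsum_finsetSum (fun _ _ => ENNReal.summable)]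
    refine tsum_congr fun t => ?_
    rw [← Summable.tsum_finsetSum (fun _ _ => ENNReal.summable)]
    refine tsum_congr fun ts => ?_
    simp only [List.sum_cons, List.cons.injEq]
    by_cases h1 : t.root = x
    · by_cases h2 : ts.map root = c
      · simp only [h1, h2, true_and, ite_mul, zero_mul, mul_ite, mul_zero]
        by_cases h3 : t.size + (ts.map size).sum = n
        · rw [if_pos h3, Finset.sum_eq_single (t.size, (ts.map size).sum)]
          · simp
          · rintro ⟨i, j⟩ _ hij
            by_cases hi : t.size = i
            · by_cases hj : (ts.map size).sum = j
              · exact absurd (by rw [hi, hj]) hij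
              · simp [hj]
            · simp [hi]
          · intro h
            exact absurd (Finset.HasAntidiagonal.mem_antidiagonal.2 h3) h
        · rw [if_neg h3]
          refine Finset.sum_eq_zero ?_
          rintro ⟨i, j⟩ hij
          rw [Finset.HasAntidiagonal.mem_antidiagonal] at hij
          by_cases hi : t.size = i
          · by_cases hj : (ts.map size).sum = j
            · exact absurd (by rw [hi, hj]; exact hij) h3
            · simp [hj]
          · simp [hi]
      · simp [h2]
    · simp [h1]

theorem coeff_zero_progenyGF (𝒬 : 𝒳 → List 𝒳 → ℝ) (a : 𝒳) : coeff 0 (progenyGF 𝒬 a) = 0 := by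
  simp only [progenyGF, coeff_mk, ENNReal.tsum_eq_zero]
  rintro ⟨b, ts⟩
  simp [size_node]

open Classical in
theorem coeff_succ_progenyGF (𝒬 : 𝒳 → List 𝒳 → ℝ) (a : 𝒳) (n : ℕ) :
    coeff (n + 1) (progenyGF 𝒬 a) =
      ∑' c, ENNReal.ofReal (𝒬 a c) * coeff n (c.map (progenyGF 𝒬)).prod := by
  simp only [coeff_prod_progenyGF, ← ENNReal.tsum_mul_left]
  rw [ENNReal.tsum_comm]
  simp only [progenyGF, coeff_mk]
  rw [← (equivNode 𝒳).tsum_eq, ENNReal.tsum_prod', tsum_eq_single a]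
  · refine tsum_congr fun ts => ?_
    rw [tsum_eq_single (ts.map root)]
    · change (if a = a ∧ (node a ts).size = n + 1 then (node a ts).offspringProd 𝒬 else 0) = _
      simp [size_node, offspringProd_node]
    · intro c hc
      simp [hc.symm]
  · intro b hb
    simp [equivNode, root, hb]

open Classical in
theorem treeMass_mgwWeight [Fintype 𝒳] (μ0 : 𝒳 → ℝ) (hμ0 : ∀ a, 0 ≤ μ0 a)
    (𝒬 : 𝒳 → List 𝒳 → ℝ) (h𝒬 : ∀ a c, 0 ≤ 𝒬 a c) (n : ℕ) :
    treeMass (mgwWeight μ0 𝒬) n =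
      ∑ a, ENNReal.ofReal (μ0 a) * coeff n (progenyGF 𝒬 a) := by
  simp only [progenyGF, coeff_mk, ← ENNReal.tsum_mul_left, treeMass]
  rw [← Summable.tsum_finsetSum (fun _ _ => ENNReal.summable)]
  refine tsum_congr fun t => ?_
  have hw : ENNReal.ofReal (mgwWeight μ0 𝒬 t) =
      ENNReal.ofReal (μ0 t.root) * t.offspringProd 𝒬 := by
    rw [mgwWeight, ENNReal.ofReal_mul (hμ0 _), offspringProd]
    congr 1
    induction t.subtrees with
    | nil => simp
    | cons s l ih => simp [ENNReal.ofReal_mul (h𝒬 _ _), ih]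
  rw [Finset.sum_eq_single t.root]
  · simp [hw]
  · intro b _ hb
    simp [hb.symm]
  · simp

theorem coeff_mul_coeff_le (f g : PowerSeries ℝ≥0∞) (n m : ℕ) :
    coeff n f * coeff m g ≤ coeff (n + m) (f * g) := by
  rw [coeff_mul]
  exact Finset.single_le_sum (f := fun p : ℕ × ℕ => coeff p.1 f * coeff p.2 g)
    (fun _ _ => zero_le) (show (n, m) ∈ _ from Finset.HasAntidiagonal.mem_antidiagonal.2 rfl)

theorem exists_coeff_prod_ne_zero (P : 𝒳 → PowerSeries ℝ≥0∞) (c : List 𝒳)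
    (h : ∀ x ∈ c, ∃ n, coeff n (P x) ≠ 0) : ∃ n, coeff n (c.map P).prod ≠ 0 := by
  induction c with
  | nil => exact ⟨0, by simp⟩
  | cons x c ih =>
    obtain ⟨n, hn⟩ := h x (by simp)
    obtain ⟨m, hm⟩ := ih fun y hy => h y (by simp [hy])
    refine ⟨n + m, fun h0 => ?_⟩
    have := coeff_mul_coeff_le (P x) (c.map P).prod n m
    rw [List.map_cons, List.prod_cons] at h0
    rw [h0, nonpos_iff_eq_zero] at this
    exact mul_ne_zero hn hm this

theorem sum_range_coeff_mul_le (f g : PowerSeries ℝ≥0∞) (n : ℕ) :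
    ∑ k ∈ Finset.range n, coeff k (f * g) ≤
      (∑ k ∈ Finset.range n, coeff k f) * ∑ k ∈ Finset.range n, coeff k g := by
  have h : ∀ k ∈ Finset.range n, coeff k (f * g) =
      ∑ p ∈ Finset.range n ×ˢ Finset.range n,
        if p.1 + p.2 = k then coeff p.1 f * coeff p.2 g else 0 := by
    intro k hk
    rw [coeff_mul, ← Finset.sum_filter]
    refine Finset.sum_congr ?_ fun _ _ => rfl
    ext ⟨i, j⟩
    simp only [Finset.HasAntidiagonal.mem_antidiagonal, Finset.mem_filter, Finset.mem_product,
      Finset.mem_range] at hk ⊢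
    omega
  rw [Finset.sum_congr rfl h, Finset.sum_comm, Finset.sum_mul_sum,
    ← Finset.sum_product' (Finset.range n) (Finset.range n) fun i j => coeff i f * coeff j g]
  refine Finset.sum_le_sum fun p _ => ?_
  rw [Finset.sum_ite_eq]
  split_ifs <;> simp

theorem sum_range_coeff_prod_le_one (P : 𝒳 → PowerSeries ℝ≥0∞) (n : ℕ)
    (h : ∀ x, ∑ k ∈ Finset.range n, coeff k (P x) ≤ 1) (c : List 𝒳) :
    ∑ k ∈ Finset.range n, coeff k (c.map P).prod ≤ 1 := by
  induction c with
  | nil =>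
    simp only [List.map_nil, List.prod_nil, coeff_one, Finset.sum_ite_eq']
    split_ifs <;> simp
  | cons x c ih =>
    rw [List.map_cons, List.prod_cons]
    exact (sum_range_coeff_mul_le _ _ _).trans (mul_le_one₀ (h x) zero_le ih)

/-- The value at `s` of a power series with coefficients in `[0, ∞]`. -/
noncomputable def evalAt (s : ℝ≥0∞) (f : PowerSeries ℝ≥0∞) : ℝ≥0∞ := ∑' n, coeff n f * s ^ n

theorem evalAt_one (s : ℝ≥0∞) : evalAt s 1 = 1 := by
  rw [evalAt, tsum_eq_single 0]
  · simp
  · intro n hn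
    simp [coeff_one, hn]

theorem evalAt_mul (s : ℝ≥0∞) (f g : PowerSeries ℝ≥0∞) :
    evalAt s (f * g) = evalAt s f * evalAt s g := by
  have h : ∀ n, coeff n (f * g) * s ^ n = ∑' p : ℕ × ℕ,
      if p.1 + p.2 = n then (coeff p.1 f * s ^ p.1) * (coeff p.2 g * s ^ p.2) else 0 := by
    intro n
    rw [coeff_mul, Finset.sum_mul, tsum_eq_sum (s := Finset.HasAntidiagonal.antidiagonal n)]
    · refine Finset.sum_congr rfl fun p hp => ?_
      rw [Finset.HasAntidiagonal.mem_antidiagonal] at hp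
      rw [if_pos hp, ← hp, pow_add]
      ring
    · intro p hp
      rw [Finset.HasAntidiagonal.mem_antidiagonal] at hp
      rw [if_neg hp]
  simp only [evalAt, h]
  rw [ENNReal.tsum_comm]
  simp only [tsum_ite_eq']
  simp_rw [← ENNReal.tsum_mul_right, ← ENNReal.tsum_mul_left]
  rw [ENNReal.tsum_prod']

theorem evalAt_list_prod (s : ℝ≥0∞) (P : 𝒳 → PowerSeries ℝ≥0∞) (c : List 𝒳) :
    evalAt s (c.map P).prod = (c.map fun x => evalAt s (P x)).prod := by
  induction c with
  | nil => simp [evalAt_one]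
  | cons x c ih => simp [evalAt_mul, ih]

theorem evalAt_progenyGF (𝒬 : 𝒳 → List 𝒳 → ℝ) (s : ℝ≥0∞) (a : 𝒳) :
    evalAt s (progenyGF 𝒬 a) = s * ∑' c, ENNReal.ofReal (𝒬 a c) *
      (c.map fun x => evalAt s (progenyGF 𝒬 x)).prod := by
  rw [evalAt, tsum_eq_zero_add' ENNReal.summable, coeff_zero_progenyGF, zero_mul, zero_add]
  simp only [coeff_succ_progenyGF, ← evalAt_list_prod]
  simp only [evalAt, ← ENNReal.tsum_mul_left, ← ENNReal.tsum_mul_right]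
  rw [ENNReal.tsum_comm]
  refine tsum_congr fun c => tsum_congr fun n => ?_
  rw [pow_succ]
  ring

theorem coeff_progenyGF_le_one (𝒬 : 𝒳 → List 𝒳 → ℝ) (h𝒬 : ∀ a c, 0 ≤ 𝒬 a c)
    (h𝒬_sum : ∀ a, HasSum (𝒬 a) 1) (a : 𝒳) (n : ℕ) : coeff n (progenyGF 𝒬 a) ≤ 1 := by
  have key : ∀ n a, ∑ k ∈ Finset.range n, coeff k (progenyGF 𝒬 a) ≤ 1 := by
    intro n
    induction n with
    | zero => simp
    | succ n ih =>
      intro a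
      rw [Finset.sum_range_succ', coeff_zero_progenyGF, add_zero]
      simp only [coeff_succ_progenyGF]
      rw [← Summable.tsum_finsetSum (fun _ _ => ENNReal.summable)]
      simp only [← Finset.mul_sum]
      calc _ ≤ ∑' c, ENNReal.ofReal (𝒬 a c) :=
            ENNReal.tsum_le_tsum fun c =>
              mul_le_of_le_one_right zero_le (sum_range_coeff_prod_le_one _ n ih c)
        _ = 1 := by
            rw [← ENNReal.ofReal_tsum_of_nonneg (h𝒬 a) (h𝒬_sum a).summable, (h𝒬_sum a).tsum_eq,
              ENNReal.ofReal_one]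
  exact (Finset.single_le_sum (f := fun k => coeff k (progenyGF 𝒬 a)) (fun _ _ => zero_le)
    (Finset.self_mem_range_succ n)).trans (key (n + 1) a)

/-- Type `a` occurs among the offspring of type `b` with positive probability. -/
def IsOffspring (𝒬 : 𝒳 → List 𝒳 → ℝ) (b a : 𝒳) : Prop := ∃ c, 𝒬 b c ≠ 0 ∧ a ∈ c

theorem meanMat_ne_zero_iff [Fintype 𝒳] [DecidableEq 𝒳] (𝒬 : 𝒳 → List 𝒳 → ℝ)
    (h𝒬 : ∀ a c, 0 ≤ 𝒬 a c) (a b : 𝒳) : meanMat 𝒬 a b ≠ 0 ↔ IsOffspring 𝒬 b a := by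
  simp only [meanMat, Matrix.of_apply, ne_eq, ENNReal.tsum_eq_zero, mul_eq_zero, not_forall, not_or,
    ENNReal.ofReal_eq_zero, Nat.cast_eq_zero, mult, List.count_eq_zero, not_not, IsOffspring]
  refine exists_congr fun c => and_congr_left fun _ => ?_
  rw [not_le]
  exact (h𝒬 b c).lt_iff_ne'

theorem matStar_ne_zero_iff [Fintype 𝒳] [DecidableEq 𝒳] (𝒬 : 𝒳 → List 𝒳 → ℝ)
    (h𝒬 : ∀ a c, 0 ≤ 𝒬 a c) (a b : 𝒳) :
    matStar (meanMat 𝒬) a b ≠ 0 ↔ Relation.TransGen (IsOffspring 𝒬) b a := by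
  simp only [matStar, Matrix.of_apply, ne_eq, ENNReal.tsum_eq_zero, not_forall]
  constructor
  · rintro ⟨k, hk⟩
    induction k generalizing a with
    | zero =>
      rw [zero_add, pow_one] at hk
      exact .single ((meanMat_ne_zero_iff 𝒬 h𝒬 a b).1 hk)
    | succ k ih =>
      rw [pow_succ', Matrix.mul_apply, Finset.sum_eq_zero_iff] at hk
      push Not at hk
      obtain ⟨x, -, hx⟩ := hk
      exact .tail (ih x (right_ne_zero_of_mul hx))
        ((meanMat_ne_zero_iff 𝒬 h𝒬 a x).1 (left_ne_zero_of_mul hx))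
  · intro h
    induction h with
    | single h => exact ⟨0, by rw [zero_add, pow_one]; exact (meanMat_ne_zero_iff 𝒬 h𝒬 _ b).2 h⟩
    | @tail x y _ hxy ih =>
      obtain ⟨k, hk⟩ := ih
      refine ⟨k + 1, ?_⟩
      rw [pow_succ', Matrix.mul_apply, Finset.sum_eq_zero_iff]
      exact fun h0 => mul_ne_zero ((meanMat_ne_zero_iff 𝒬 h𝒬 y x).2 hxy) hk (h0 x (by simp))

theorem sum_map_eq_sum_count [Fintype 𝒳] [DecidableEq 𝒳] (f : 𝒳 → ℝ) (c : List 𝒳) :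
    (c.map f).sum = ∑ a, (mult a c : ℝ) * f a := by
  induction c with
  | nil => simp [mult]
  | cons x c ih =>
    simp only [mult] at ih
    simp [mult, List.count_cons, ih, add_mul, Finset.sum_add_distrib, add_comm]

theorem summable_mul_mult [DecidableEq 𝒳] {𝒬 : 𝒳 → List 𝒳 → ℝ}
    (h𝒬 : ∀ a c, 0 ≤ 𝒬 a c)
    (hsecond : ∀ a : 𝒳, Summable (fun c : List 𝒳 => 𝒬 a c * (c.length : ℝ) ^ 2)) (a b : 𝒳) :
    Summable fun c => 𝒬 b c * (mult a c : ℝ) := by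
  refine (hsecond b).of_nonneg_of_le (fun c => mul_nonneg (h𝒬 b c) (Nat.cast_nonneg _))
    fun c => mul_le_mul_of_nonneg_left ?_ (h𝒬 b c)
  exact_mod_cast (List.count_le_length (a := a)).trans (Nat.le_self_pow two_ne_zero _)

theorem exists_perm_cons_cons_of_two_le_countP {α : Type*} {p : α → Bool} {c : List α}
    (h : 2 ≤ c.countP p) : ∃ x y l, p x = true ∧ p y = true ∧ c.Perm (x :: y :: l) := by
  rw [List.countP_eq_length_filter] at h
  match hc : c.filter p with
  | [] => simp [hc] at h
  | [x] => simp [hc] at h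
  | x :: y :: l =>
    have hmem : ∀ z ∈ c.filter p, p z = true := fun z hz => (List.mem_filter.1 hz).2
    refine ⟨x, y, l ++ c.filter (fun z => !p z), hmem x (by simp [hc]), hmem y (by simp [hc]), ?_⟩
    have := (List.filter_append_perm p c).symm
    rwa [hc] at this

theorem sum_map_ite_eq_countP [DecidableEq 𝒳] (s : Finset 𝒳) (c : List 𝒳) :
    (c.map fun x => if x ∈ s then (1 : ℝ) else 0).sum = (c.countP fun x => decide (x ∈ s) : ℕ) := by
  induction c with
  | nil => simp
  | cons x c ih =>
    rw [List.map_cons, List.sum_cons, ih, List.countP_cons]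
    by_cases hx : x ∈ s <;> simp [hx, add_comm]

theorem coeff_prod_eq_zero_of_mem (P : 𝒳 → PowerSeries ℝ≥0∞) {n : ℕ} {c : List 𝒳} {x : 𝒳}
    (hx : x ∈ c) (h : ∀ m ≤ n, coeff m (P x) = 0) : coeff n (c.map P).prod = 0 := by
  classical
  obtain ⟨l, hl⟩ : ∃ l, c.Perm (x :: l) := ⟨c.erase x, List.perm_cons_erase hx⟩
  rw [(hl.map P).prod_eq, List.map_cons, List.prod_cons, coeff_mul]
  refine Finset.sum_eq_zero fun p hp => ?_
  rw [Finset.HasAntidiagonal.mem_antidiagonal] at hp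
  rw [h p.1 (by omega), zero_mul]

section Stationarity

variable [Fintype 𝒳] [DecidableEq 𝒳] {𝒬 : 𝒳 → List 𝒳 → ℝ}

theorem summable_mul_sum_map (h𝒬 : ∀ a c, 0 ≤ 𝒬 a c)
    (hsecond : ∀ a : 𝒳, Summable (fun c : List 𝒳 => 𝒬 a c * (c.length : ℝ) ^ 2))
    (f : 𝒳 → ℝ) (b : 𝒳) : Summable fun c => 𝒬 b c * (c.map f).sum := by
  simp only [sum_map_eq_sum_count, Finset.mul_sum, ← mul_assoc]
  exact summable_sum fun a _ => (summable_mul_mult h𝒬 hsecond a b).mul_right _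

theorem tsum_mul_sum_map (h𝒬 : ∀ a c, 0 ≤ 𝒬 a c)
    (hsecond : ∀ a : 𝒳, Summable (fun c : List 𝒳 => 𝒬 a c * (c.length : ℝ) ^ 2))
    (f : 𝒳 → ℝ) (b : 𝒳) :
    ∑' c, 𝒬 b c * (c.map f).sum = ∑ a, meanMatR 𝒬 a b * f a := by
  simp only [sum_map_eq_sum_count, Finset.mul_sum, ← mul_assoc]
  rw [Summable.tsum_finsetSum fun a _ => (summable_mul_mult h𝒬 hsecond a b).mul_right _]
  simp only [tsum_mul_right, meanMatR, Matrix.of_apply]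

theorem sum_mul_tsum_eq (h𝒬 : ∀ a c, 0 ≤ 𝒬 a c)
    (hsecond : ∀ a : 𝒳, Summable (fun c : List 𝒳 => 𝒬 a c * (c.length : ℝ) ^ 2))
    {u : 𝒳 → ℝ} (hu : ∀ a, ∑ b, meanMatR 𝒬 a b * u b = u a) (f : 𝒳 → ℝ) :
    ∑ b, u b * ∑' c, 𝒬 b c * (c.map f).sum = ∑ a, u a * f a := by
  simp only [tsum_mul_sum_map h𝒬 hsecond, Finset.mul_sum]
  rw [Finset.sum_comm]
  refine Finset.sum_congr rfl fun a _ => ?_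
  rw [← hu a, Finset.sum_mul]
  exact Finset.sum_congr rfl fun b _ => by ring

/-- For a critical kernel every superharmonic function is harmonic. -/
theorem harmonic_of_superharmonic (h𝒬 : ∀ a c, 0 ≤ 𝒬 a c)
    (hsecond : ∀ a : 𝒳, Summable (fun c : List 𝒳 => 𝒬 a c * (c.length : ℝ) ^ 2))
    (hcrit : CriticalKernel 𝒬) {f : 𝒳 → ℝ} (h : ∀ b, ∑' c, 𝒬 b c * (c.map f).sum ≤ f b)
    (b : 𝒳) : ∑' c, 𝒬 b c * (c.map f).sum = f b := by
  obtain ⟨u, hu0, hu⟩ := hcrit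
  have := (Finset.sum_eq_sum_iff_of_le fun b _ =>
    mul_le_mul_of_nonneg_left (h b) (hu0 b).le).1 (sum_mul_tsum_eq h𝒬 hsecond hu f)
  exact mul_left_cancel₀ (hu0 b).ne' (this b (Finset.mem_univ b))

/-- For a critical kernel every subharmonic function is harmonic. -/
theorem harmonic_of_subharmonic (h𝒬 : ∀ a c, 0 ≤ 𝒬 a c)
    (hsecond : ∀ a : 𝒳, Summable (fun c : List 𝒳 => 𝒬 a c * (c.length : ℝ) ^ 2))
    (hcrit : CriticalKernel 𝒬) {f : 𝒳 → ℝ} (h : ∀ b, f b ≤ ∑' c, 𝒬 b c * (c.map f).sum)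
    (b : 𝒳) : ∑' c, 𝒬 b c * (c.map f).sum = f b := by
  obtain ⟨u, hu0, hu⟩ := hcrit
  have := (Finset.sum_eq_sum_iff_of_le fun b _ =>
    mul_le_mul_of_nonneg_left (h b) (hu0 b).le).1 (sum_mul_tsum_eq h𝒬 hsecond hu f).symm
  exact (mul_left_cancel₀ (hu0 b).ne' (this b (Finset.mem_univ b))).symm

theorem progenyGF_ne_zero (h𝒬 : ∀ a c, 0 ≤ 𝒬 a c) (h𝒬_sum : ∀ a, HasSum (𝒬 a) 1)
    (hsecond : ∀ a : 𝒳, Summable (fun c : List 𝒳 => 𝒬 a c * (c.length : ℝ) ^ 2))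
    (hcrit : CriticalKernel 𝒬) {a : 𝒳} (ha : ∃ n, coeff n (progenyGF 𝒬 a) ≠ 0) {b : 𝒳}
    (hab : Relation.TransGen (IsOffspring 𝒬) a b) : ∃ n, coeff n (progenyGF 𝒬 b) ≠ 0 := by
  classical
  set f : 𝒳 → ℝ := fun x => if ∃ n, coeff n (progenyGF 𝒬 x) ≠ 0 then 0 else 1 with hf
  have hf0 : ∀ x, 0 ≤ f x := fun x => by simp only [hf]; split_ifs <;> norm_num
  have hsum0 : ∀ c : List 𝒳, 0 ≤ (c.map f).sum := fun c =>
    List.sum_nonneg fun y hy => by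
      obtain ⟨x, -, rfl⟩ := List.mem_map.1 hy
      exact hf0 x
  have hle : ∀ (c : List 𝒳), ∀ x ∈ c, f x ≤ (c.map f).sum := fun c x hx =>
    List.single_le_sum (fun y hy => by
      obtain ⟨x, -, rfl⟩ := List.mem_map.1 hy
      exact hf0 x) _ (List.mem_map_of_mem hx)
  have hsub : ∀ x, f x ≤ ∑' c, 𝒬 x c * (c.map f).sum := by
    intro x
    by_cases hx : ∃ n, coeff n (progenyGF 𝒬 x) ≠ 0
    · rw [show f x = 0 from if_pos hx]
      exact tsum_nonneg fun c => mul_nonneg (h𝒬 x c) (hsum0 c)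
    · rw [show f x = 1 from if_neg hx, ← (h𝒬_sum x).tsum_eq]
      refine (h𝒬_sum x).summable.tsum_le_tsum (fun c => ?_)
        (summable_mul_sum_map h𝒬 hsecond f x)
      by_cases hc : 𝒬 x c = 0
      · simp [hc]
      refine le_mul_of_one_le_right (h𝒬 x c) ?_
      by_contra hlt
      refine hx ?_
      obtain ⟨n, hn⟩ := exists_coeff_prod_ne_zero (progenyGF 𝒬) c fun y hy => by
        by_contra hy0
        have := hle c y hy
        rw [show f y = 1 from if_neg hy0] at this
        exact hlt this
      refine ⟨n + 1, ?_⟩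
      rw [coeff_succ_progenyGF, ne_eq, ENNReal.tsum_eq_zero, not_forall]
      refine ⟨c, mul_ne_zero ?_ hn⟩
      rw [ne_eq, ENNReal.ofReal_eq_zero, not_le]
      exact (h𝒬 x c).lt_of_ne' hc
  have hstep : ∀ x y, IsOffspring 𝒬 x y → f x = 0 → f y = 0 := by
    rintro x y ⟨c, hc, hy⟩ hx
    have h0 := harmonic_of_subharmonic h𝒬 hsecond hcrit hsub x
    rw [hx] at h0
    have h1 := (summable_mul_sum_map h𝒬 hsecond f x).hasSum
    rw [h0, hasSum_zero_iff_of_nonneg fun c => mul_nonneg (h𝒬 x c) (hsum0 c)] at h1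
    have h2 := (mul_eq_zero.1 (congrFun h1 c)).resolve_left hc
    exact le_antisymm (h2 ▸ hle c y hy) (hf0 y)
  have hfb : f b = 0 := by
    induction hab with
    | single h => exact hstep _ _ h (if_pos ha)
    | tail _ h ih => exact hstep _ _ h ih
  by_contra hb
  rw [show f b = 1 from if_neg hb] at hfb
  exact one_ne_zero hfb

theorem exists_two_recurrent_offspring (h𝒬 : ∀ a c, 0 ≤ 𝒬 a c)
    (h𝒬_sum : ∀ a, HasSum (𝒬 a) 1)
    (hsecond : ∀ a : 𝒳, Summable (fun c : List 𝒳 => 𝒬 a c * (c.length : ℝ) ^ 2))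
    (hcrit : CriticalKernel 𝒬) (Xr : Finset 𝒳)
    (hclosed : ∀ a b, IsOffspring 𝒬 b a → a ∈ Xr → b ∈ Xr) {a : 𝒳} (ha : a ∈ Xr)
    (hne : ∃ n, coeff n (progenyGF 𝒬 a) ≠ 0) :
    ∃ b ∈ Xr, ∃ c x y l, 𝒬 b c ≠ 0 ∧ x ∈ Xr ∧ y ∈ Xr ∧ c.Perm (x :: y :: l) := by
  by_contra hcon
  have hcount : ∀ b ∈ Xr, ∀ c, 𝒬 b c ≠ 0 → c.countP (fun x => decide (x ∈ Xr)) ≤ 1 := by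
    intro b hb c hc
    by_contra h
    obtain ⟨x, y, l, hx, hy, hp⟩ := exists_perm_cons_cons_of_two_le_countP (not_le.1 h)
    exact hcon ⟨b, hb, c, x, y, l, hc, of_decide_eq_true hx, of_decide_eq_true hy, hp⟩
  set f : 𝒳 → ℝ := fun x => if x ∈ Xr then 1 else 0 with hf
  have hfc : ∀ c : List 𝒳, (c.map f).sum = (c.countP fun x => decide (x ∈ Xr) : ℕ) :=
    sum_map_ite_eq_countP Xr
  have hle : ∀ b ∈ Xr, ∀ c, 𝒬 b c * (c.map f).sum ≤ 𝒬 b c := by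
    intro b hb c
    by_cases hc : 𝒬 b c = 0
    · simp [hc]
    · refine mul_le_of_le_one_right (h𝒬 b c) ?_
      rw [hfc]
      exact_mod_cast hcount b hb c hc
  have hsup : ∀ b, ∑' c, 𝒬 b c * (c.map f).sum ≤ f b := by
    intro b
    by_cases hb : b ∈ Xr
    · rw [show f b = 1 from if_pos hb, ← (h𝒬_sum b).tsum_eq]
      exact (summable_mul_sum_map h𝒬 hsecond f b).tsum_le_tsum (hle b hb) (h𝒬_sum b).summable
    · rw [show f b = 0 from if_neg hb]
      refine ((tsum_congr fun c => ?_).trans tsum_zero).le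
      by_cases hc : 𝒬 b c = 0
      · simp [hc]
      · rw [hfc, List.countP_eq_zero.2, Nat.cast_zero, mul_zero]
        intro x hx hxr
        exact hb (hclosed x b ⟨c, hc, hx⟩ (of_decide_eq_true hxr))
  have hone : ∀ b ∈ Xr, ∀ c, 𝒬 b c ≠ 0 → ∃ x ∈ c, x ∈ Xr := by
    intro b hb c hc
    by_contra hx
    have h0 : (c.map f).sum = 0 := by
      rw [hfc, List.countP_eq_zero.2, Nat.cast_zero]
      intro x hxc hxr
      exact hx ⟨x, hxc, of_decide_eq_true hxr⟩
    have hlt := (summable_mul_sum_map h𝒬 hsecond f b).tsum_lt_tsum (i := c) (hle b hb)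
      (by rw [h0, mul_zero]; exact (h𝒬 b c).lt_of_ne' hc) (h𝒬_sum b).summable
    rw [harmonic_of_superharmonic h𝒬 hsecond hcrit hsup b, (h𝒬_sum b).tsum_eq,
      show f b = 1 from if_pos hb] at hlt
    exact lt_irrefl _ hlt
  have hzero : ∀ n, ∀ b ∈ Xr, coeff n (progenyGF 𝒬 b) = 0 := by
    intro n
    induction n using Nat.strong_induction_on with
    | _ n ih =>
      intro b hb
      cases n with
      | zero => exact coeff_zero_progenyGF 𝒬 b
      | succ n =>
        rw [coeff_succ_progenyGF, ENNReal.tsum_eq_zero]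
        intro c
        by_cases hc : 𝒬 b c = 0
        · simp [hc]
        · obtain ⟨x, hxc, hxr⟩ := hone b hb c hc
          rw [coeff_prod_eq_zero_of_mem (progenyGF 𝒬) hxc fun m hm => ih m (by omega) x hxr,
            mul_zero]
  obtain ⟨n, hn⟩ := hne
  exact hn (hzero n a ha)

end Stationarity

theorem mul_coeff_le_coeff_succ {𝒬 : 𝒳 → List 𝒳 → ℝ} (b : 𝒳) {c c' : List 𝒳}
    (hc : c.Perm c') (n : ℕ) :
    ENNReal.ofReal (𝒬 b c) * coeff n (c'.map (progenyGF 𝒬)).prod ≤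
      coeff (n + 1) (progenyGF 𝒬 b) := by
  rw [coeff_succ_progenyGF, ← (hc.map (progenyGF 𝒬)).prod_eq]
  exact ENNReal.le_tsum (f := fun c => ENNReal.ofReal (𝒬 b c) *
    coeff n (c.map (progenyGF 𝒬)).prod) c

theorem exists_mul_coeff_le_of_isOffspring {𝒬 : 𝒳 → List 𝒳 → ℝ} (h𝒬 : ∀ a c, 0 ≤ 𝒬 a c)
    (hne : ∀ b, ∃ n, coeff n (progenyGF 𝒬 b) ≠ 0) {b x : 𝒳} (h : IsOffspring 𝒬 b x) :
    ∃ (k : ℕ) (w : ℝ≥0∞), w ≠ 0 ∧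
      ∀ n, w * coeff n (progenyGF 𝒬 x) ≤ coeff (n + k) (progenyGF 𝒬 b) := by
  classical
  obtain ⟨c, hc, hx⟩ := h
  obtain ⟨k, hk⟩ := exists_coeff_prod_ne_zero (progenyGF 𝒬) (c.erase x) fun y _ => hne y
  have hc' : ENNReal.ofReal (𝒬 b c) ≠ 0 := by
    rw [ne_eq, ENNReal.ofReal_eq_zero, not_le]
    exact (h𝒬 b c).lt_of_ne' hc
  refine ⟨k + 1, ENNReal.ofReal (𝒬 b c) * coeff k ((c.erase x).map (progenyGF 𝒬)).prod,
    mul_ne_zero hc' hk, fun n => ?_⟩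
  refine le_trans ?_ (mul_coeff_le_coeff_succ b (List.perm_cons_erase hx) (n + k))
  rw [mul_assoc, mul_comm (coeff k _), List.map_cons, List.prod_cons]
  gcongr
  exact coeff_mul_coeff_le _ _ _ _

theorem exists_mul_coeff_le_of_transGen {𝒬 : 𝒳 → List 𝒳 → ℝ} (h𝒬 : ∀ a c, 0 ≤ 𝒬 a c)
    (hne : ∀ b, ∃ n, coeff n (progenyGF 𝒬 b) ≠ 0) {b x : 𝒳}
    (h : Relation.TransGen (IsOffspring 𝒬) b x) :
    ∃ (k : ℕ) (w : ℝ≥0∞), w ≠ 0 ∧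
      ∀ n, w * coeff n (progenyGF 𝒬 x) ≤ coeff (n + k) (progenyGF 𝒬 b) := by
  induction h with
  | single h => exact exists_mul_coeff_le_of_isOffspring h𝒬 hne h
  | tail _ h ih =>
    obtain ⟨k, w, hw, hk⟩ := ih
    obtain ⟨k', w', hw', hk'⟩ := exists_mul_coeff_le_of_isOffspring h𝒬 hne h
    refine ⟨k' + k, w * w', mul_ne_zero hw hw', fun n => ?_⟩
    rw [mul_assoc, ← add_assoc]
    exact (mul_le_mul_right (hk' n) w).trans (hk _)

/-- Grafting two trees of sizes `n` and `m` onto a fixed tree with two vertices of type `a`. -/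
theorem exists_mul_coeff_mul_coeff_le {𝒬 : 𝒳 → List 𝒳 → ℝ} (h𝒬 : ∀ a c, 0 ≤ 𝒬 a c)
    (hne : ∀ b, ∃ n, coeff n (progenyGF 𝒬 b) ≠ 0) {a b x y : 𝒳} {c l : List 𝒳}
    (hab : Relation.TransGen (IsOffspring 𝒬) a b) (hxa : Relation.TransGen (IsOffspring 𝒬) x a)
    (hya : Relation.TransGen (IsOffspring 𝒬) y a) (hc : 𝒬 b c ≠ 0)
    (hp : c.Perm (x :: y :: l)) :
    ∃ (k : ℕ) (w : ℝ≥0∞), w ≠ 0 ∧ ∀ n m,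
      w * (coeff n (progenyGF 𝒬 a) * coeff m (progenyGF 𝒬 a)) ≤
        coeff (n + m + k) (progenyGF 𝒬 a) := by
  obtain ⟨k₁, w₁, hw₁, h₁⟩ := exists_mul_coeff_le_of_transGen h𝒬 hne hab
  obtain ⟨k₂, w₂, hw₂, h₂⟩ := exists_mul_coeff_le_of_transGen h𝒬 hne hxa
  obtain ⟨k₃, w₃, hw₃, h₃⟩ := exists_mul_coeff_le_of_transGen h𝒬 hne hya
  obtain ⟨k₄, hk₄⟩ := exists_coeff_prod_ne_zero (progenyGF 𝒬) l fun y _ => hne y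
  have hc' : ENNReal.ofReal (𝒬 b c) ≠ 0 := by
    rw [ne_eq, ENNReal.ofReal_eq_zero, not_le]
    exact (h𝒬 b c).lt_of_ne' hc
  refine ⟨k₂ + k₃ + k₄ + 1 + k₁, w₁ * (ENNReal.ofReal (𝒬 b c) *
    (w₂ * (w₃ * coeff k₄ (l.map (progenyGF 𝒬)).prod))), ?_, fun n m => ?_⟩
  · exact mul_ne_zero hw₁ (mul_ne_zero hc' (mul_ne_zero hw₂ (mul_ne_zero hw₃ hk₄)))
  calc _ = w₁ * (ENNReal.ofReal (𝒬 b c) * ((w₂ * coeff n (progenyGF 𝒬 a)) *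
        ((w₃ * coeff m (progenyGF 𝒬 a)) * coeff k₄ (l.map (progenyGF 𝒬)).prod))) := by ring
    _ ≤ w₁ * (ENNReal.ofReal (𝒬 b c) * (coeff (n + k₂) (progenyGF 𝒬 x) *
        (coeff (m + k₃) (progenyGF 𝒬 y) * coeff k₄ (l.map (progenyGF 𝒬)).prod))) := by
      gcongr
      · exact h₂ n
      · exact h₃ m
    _ ≤ w₁ * (ENNReal.ofReal (𝒬 b c) * coeff ((n + k₂) + ((m + k₃) + k₄))
        ((x :: y :: l).map (progenyGF 𝒬)).prod) := by
      rw [List.map_cons, List.prod_cons, List.map_cons, List.prod_cons]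
      gcongr
      refine le_trans ?_ (coeff_mul_coeff_le _ _ _ _)
      gcongr
      exact coeff_mul_coeff_le _ _ _ _
    _ ≤ w₁ * coeff ((n + k₂) + ((m + k₃) + k₄) + 1) (progenyGF 𝒬 b) := by
      gcongr
      exact mul_coeff_le_coeff_succ b hp _
    _ ≤ _ := h₁ _
    _ = _ := by congr 2; ring

theorem prod_map_eq_exp_sum_map_log {F : 𝒳 → ℝ≥0∞} (hF0 : ∀ a, F a ≠ 0) (hF : ∀ a, F a ≠ ∞)
    (c : List 𝒳) :
    (c.map F).prod = ENNReal.ofReal (Real.exp (c.map fun a => Real.log (F a).toReal).sum) := by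
  induction c with
  | nil => simp
  | cons x c ih =>
    rw [List.map_cons, List.prod_cons, ih, List.map_cons, List.sum_cons, Real.exp_add,
      ENNReal.ofReal_mul (Real.exp_nonneg _), Real.exp_log (ENNReal.toReal_pos (hF0 x) (hF x)),
      ENNReal.ofReal_toReal (hF x)]

/-- Jensen's inequality for the exponential function and a discrete probability measure. -/
theorem exp_tsum_mul_le {α : Type*} {q X : α → ℝ} (hq : ∀ a, 0 ≤ q a) (hq1 : HasSum q 1)
    (hX : Summable fun a => q a * X a) (hexp : Summable fun a => q a * Real.exp (X a)) :
    Real.exp (∑' a, q a * X a) ≤ ∑' a, q a * Real.exp (X a) := by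
  set m := ∑' a, q a * X a with hm
  have h1 : HasSum (fun a => Real.exp m * (q a * X a + (1 - m) * q a))
      (Real.exp m * (m + (1 - m) * 1)) :=
    (hX.hasSum.add (hq1.mul_left (1 - m))).mul_left _
  have h2 := hasSum_le (fun a => ?_) h1 hexp.hasSum
  · simpa using h2
  · have h3 : Real.exp (X a) = Real.exp m * Real.exp (X a - m) := by
      rw [← Real.exp_add]; ring_nf
    rw [h3]
    have h4 := Real.add_one_le_exp (X a - m)
    calc Real.exp m * (q a * X a + (1 - m) * q a)
        = q a * (Real.exp m * (X a - m + 1)) := by ring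
      _ ≤ _ := by gcongr; exact hq a

theorem evalAt_progenyGF_eq_top [Fintype 𝒳] [DecidableEq 𝒳] {𝒬 : 𝒳 → List 𝒳 → ℝ}
    (h𝒬 : ∀ a c, 0 ≤ 𝒬 a c) (h𝒬_sum : ∀ a, HasSum (𝒬 a) 1)
    (hsecond : ∀ a : 𝒳, Summable (fun c : List 𝒳 => 𝒬 a c * (c.length : ℝ) ^ 2))
    (hcrit : CriticalKernel 𝒬) (hne : ∀ b, ∃ n, coeff n (progenyGF 𝒬 b) ≠ 0) {a : 𝒳}
    (ha : ∀ b, Relation.TransGen (IsOffspring 𝒬) a b) {s : ℝ≥0∞} (hs : 1 < s) (hs' : s ≠ ∞) :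
    evalAt s (progenyGF 𝒬 a) = ∞ := by
  by_contra htop
  set F : 𝒳 → ℝ≥0∞ := fun b => evalAt s (progenyGF 𝒬 b) with hFdef
  have hs0 : s ≠ 0 := (zero_lt_one.trans hs).ne'
  have hF0 : ∀ b, F b ≠ 0 := by
    intro b h0
    obtain ⟨n, hn⟩ := hne b
    exact mul_ne_zero hn (pow_ne_zero n hs0) (ENNReal.tsum_eq_zero.1 h0 n)
  have hF : ∀ b, F b ≠ ∞ := by
    intro b hb
    obtain ⟨k, w, hw, hk⟩ := exists_mul_coeff_le_of_transGen h𝒬 hne (ha b)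
    refine htop (top_le_iff.1 ?_)
    calc ∞ = w * F b := by rw [hb, ENNReal.mul_top hw]
      _ = ∑' n, w * coeff n (progenyGF 𝒬 b) * s ^ n := by
        simp only [hFdef, evalAt, ← ENNReal.tsum_mul_left, mul_assoc]
      _ ≤ ∑' n, coeff (n + k) (progenyGF 𝒬 a) * s ^ (n + k) := by
        refine ENNReal.tsum_le_tsum fun n => ?_
        gcongr
        · exact hk n
        · exact hs.le
        · exact Nat.le_add_right n k
      _ ≤ evalAt s (progenyGF 𝒬 a) :=
        ENNReal.tsum_comp_le_tsum_of_injective (add_left_injective k)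
          (fun n => coeff n (progenyGF 𝒬 a) * s ^ n)
  set f : 𝒳 → ℝ := fun b => Real.log (F b).toReal with hf
  have hs1 : 1 < s.toReal := by
    rw [← ENNReal.toReal_one]
    exact (ENNReal.toReal_lt_toReal ENNReal.one_ne_top hs').2 hs
  have hsup : ∀ b, Real.log s.toReal + ∑' c, 𝒬 b c * (c.map f).sum ≤ f b := by
    intro b
    have hFb : F b = s * ∑' c, ENNReal.ofReal (𝒬 b c * Real.exp (c.map f).sum) := by
      refine (evalAt_progenyGF 𝒬 s b).trans ?_
      congr 1
      refine tsum_congr fun c => ?_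
      rw [ENNReal.ofReal_mul (h𝒬 b c), ← prod_map_eq_exp_sum_map_log hF0 hF]
    have hfin : ∑' c, ENNReal.ofReal (𝒬 b c * Real.exp (c.map f).sum) ≠ ∞ := by
      intro h
      rw [h, ENNReal.mul_top hs0] at hFb
      exact hF b hFb
    have hnn : ∀ c, 0 ≤ 𝒬 b c * Real.exp (c.map f).sum := fun c =>
      mul_nonneg (h𝒬 b c) (Real.exp_nonneg _)
    have hsummable : Summable fun c => 𝒬 b c * Real.exp (c.map f).sum := by
      refine (ENNReal.summable_toReal hfin).congr fun c => ?_
      rw [ENNReal.toReal_ofReal (hnn c)]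
    rw [← ENNReal.ofReal_tsum_of_nonneg hnn hsummable] at hFb
    have hjensen := exp_tsum_mul_le (h𝒬 b) (h𝒬_sum b) (summable_mul_sum_map h𝒬 hsecond f b)
      hsummable
    have hreal : (F b).toReal = s.toReal * ∑' c, 𝒬 b c * Real.exp (c.map f).sum := by
      rw [hFb, ENNReal.toReal_mul, ENNReal.toReal_ofReal (tsum_nonneg hnn)]
    have hpos : 0 < ∑' c, 𝒬 b c * Real.exp (c.map f).sum := (Real.exp_pos _).trans_le hjensen
    rw [hf]
    simp only
    rw [hreal, Real.log_mul (by linarith) hpos.ne']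
    gcongr
    rwa [Real.le_log_iff_exp_le hpos]
  have hlog : 0 < Real.log s.toReal := Real.log_pos hs1
  have := harmonic_of_superharmonic h𝒬 hsecond hcrit (f := f)
    (fun b => by linarith [hsup b]) a
  linarith [hsup a]

theorem exists_mul_pow_le_of_pow_mul_le_add {p : ℕ → ℝ≥0∞} {ρ : ℝ≥0∞} {d : ℕ} (hd : 0 < d)
    (hρ1 : ρ ≤ 1) (h : ∀ n, ρ ^ d * p n ≤ p (n + d)) :
    ∃ δ : ℝ≥0∞, δ ≠ 0 ∧ ∀ n, p n ≠ 0 → δ * ρ ^ n ≤ p n := by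
  classical
  have hiter : ∀ n m, ρ ^ (d * m) * p n ≤ p (n + d * m) := by
    intro n m
    induction m with
    | zero => simp
    | succ m ih =>
      calc ρ ^ (d * (m + 1)) * p n = ρ ^ d * (ρ ^ (d * m) * p n) := by
            rw [mul_add, mul_one, pow_add]; ring
        _ ≤ ρ ^ d * p (n + d * m) := by gcongr
        _ ≤ _ := h _
        _ = p (n + d * (m + 1)) := by rw [mul_add, mul_one, add_assoc]
  have hclass : ∀ i, ∃ δ : ℝ≥0∞, δ ≠ 0 ∧
      ∀ j, p (i + d * j) ≠ 0 → δ * ρ ^ (i + d * j) ≤ p (i + d * j) := by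
    intro i
    by_cases hex : ∃ j, p (i + d * j) ≠ 0
    · refine ⟨p (i + d * Nat.find hex), Nat.find_spec hex, fun j hj => ?_⟩
      obtain ⟨m, rfl⟩ := Nat.exists_eq_add_of_le (Nat.find_min' hex hj)
      calc p (i + d * Nat.find hex) * ρ ^ (i + d * (Nat.find hex + m))
          ≤ p (i + d * Nat.find hex) * ρ ^ (d * m) := by
            refine mul_le_mul_right (pow_le_pow_of_le_one zero_le hρ1 ?_) _
            rw [mul_add]
            omega
        _ ≤ p (i + d * Nat.find hex + d * m) := by rw [mul_comm]; exact hiter _ _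
        _ = _ := by rw [mul_add, add_assoc]
    · exact ⟨1, one_ne_zero, fun j hj => (hex ⟨j, hj⟩).elim⟩
  choose δ hδ0 hδ using hclass
  refine ⟨(Finset.range d).inf δ, ?_, fun n hn => ?_⟩
  · refine ((Finset.lt_inf_iff ENNReal.zero_lt_top).2 fun i _ => ?_).ne'
    exact pos_iff_ne_zero.2 (hδ0 i)
  · have hn' := hδ (n % d) (n / d)
    rw [Nat.mod_add_div] at hn'
    refine le_trans ?_ (hn' hn)
    gcongr
    exact Finset.inf_le (Finset.mem_range.2 (Nat.mod_lt n hd))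

theorem exists_mul_pow_le_coeff [Fintype 𝒳] [DecidableEq 𝒳] {𝒬 : 𝒳 → List 𝒳 → ℝ}
    (h𝒬 : ∀ a c, 0 ≤ 𝒬 a c) (h𝒬_sum : ∀ a, HasSum (𝒬 a) 1)
    (hsecond : ∀ a : 𝒳, Summable (fun c : List 𝒳 => 𝒬 a c * (c.length : ℝ) ^ 2))
    (hcrit : CriticalKernel 𝒬) {Xr : Finset 𝒳}
    (hrec : ∀ b ∈ Xr, ∀ a, Relation.TransGen (IsOffspring 𝒬) b a)
    (hclosed : ∀ a b, IsOffspring 𝒬 b a → a ∈ Xr → b ∈ Xr)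
    (hne : ∀ b, ∃ n, coeff n (progenyGF 𝒬 b) ≠ 0) {a : 𝒳} (ha : a ∈ Xr)
    {ρ : ℝ≥0∞} (hρ0 : ρ ≠ 0) (hρ : ρ < 1) :
    ∃ δ : ℝ≥0∞, δ ≠ 0 ∧
      ∀ n, coeff n (progenyGF 𝒬 a) ≠ 0 → δ * ρ ^ n ≤ coeff n (progenyGF 𝒬 a) := by
  obtain ⟨b, hb, c, x, y, l, hc, hx, hy, hp⟩ :=
    exists_two_recurrent_offspring h𝒬 h𝒬_sum hsecond hcrit Xr hclosed ha (hne a)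
  obtain ⟨k, w, hw, hk⟩ := exists_mul_coeff_mul_coeff_le h𝒬 hne (hrec a ha b) (hrec x hx a)
    (hrec y hy a) hc hp
  obtain ⟨m, hm⟩ : ∃ m, ρ ^ (m + k) < w * coeff m (progenyGF 𝒬 a) := by
    by_contra hcon
    push Not at hcon
    obtain ⟨s, hs1, hs⟩ := exists_between (ENNReal.one_lt_inv.2 hρ)
    have htop := evalAt_progenyGF_eq_top h𝒬 h𝒬_sum hsecond hcrit hne (hrec a ha) hs1
      (hs.trans_le le_top).ne
    have hρs : ρ * s < 1 := by
      rw [← ENNReal.mul_inv_cancel hρ0 hρ.ne_top]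
      exact (ENNReal.mul_lt_mul_iff_right hρ0 hρ.ne_top).2 hs
    have : w * evalAt s (progenyGF 𝒬 a) ≤ (1 - ρ * s)⁻¹ := by
      rw [evalAt, ← ENNReal.tsum_mul_left, ← ENNReal.tsum_geometric]
      refine ENNReal.tsum_le_tsum fun n => ?_
      rw [← mul_assoc, mul_pow]
      gcongr
      exact (hcon n).trans (pow_le_pow_of_le_one zero_le hρ.le (Nat.le_add_right n k))
    rw [htop, ENNReal.mul_top hw, top_le_iff, ENNReal.inv_eq_top, tsub_eq_zero_iff_le] at this
    exact hρs.not_ge this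
  refine exists_mul_pow_le_of_pow_mul_le_add (d := m + k) ?_ hρ.le fun n => ?_
  · rcases Nat.eq_zero_or_pos m with rfl | hpos
    · simp [coeff_zero_progenyGF] at hm
    · omega
  · calc ρ ^ (m + k) * coeff n (progenyGF 𝒬 a)
        ≤ w * coeff m (progenyGF 𝒬 a) * coeff n (progenyGF 𝒬 a) := by gcongr
      _ = w * (coeff n (progenyGF 𝒬 a) * coeff m (progenyGF 𝒬 a)) := by ring
      _ ≤ _ := hk n m
      _ = _ := by rw [add_assoc]

theorem coeff_prod_eq_zero_of_lt {P : 𝒳 → PowerSeries ℝ≥0∞} {N : ℕ} {c : List 𝒳}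
    (h : ∀ x ∈ c, ∀ n, N < n → coeff n (P x) = 0) {n : ℕ} (hn : N * c.length < n) :
    coeff n (c.map P).prod = 0 := by
  induction c generalizing n with
  | nil =>
    have : n ≠ 0 := by simp at hn; omega
    simp [coeff_one, this]
  | cons x c ih =>
    rw [List.map_cons, List.prod_cons, coeff_mul]
    refine Finset.sum_eq_zero fun p hp => ?_
    rw [Finset.HasAntidiagonal.mem_antidiagonal] at hp
    rw [List.length_cons, mul_add, mul_one] at hn
    by_cases h1 : N < p.1
    · rw [h x (by simp) _ h1, zero_mul]
    · rw [ih (fun y hy => h y (by simp [hy])) (by omega), mul_zero]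

theorem exists_forall_coeff_eq_zero_of_transient [Finite 𝒳] [DecidableEq 𝒳]
    {𝒬 : 𝒳 → List 𝒳 → ℝ} {Xt : Finset 𝒳} (htrans : BoundedTransient 𝒬 Xt)
    (hirrefl : ∀ b ∈ Xt, ¬ Relation.TransGen (IsOffspring 𝒬) b b)
    (hclosed : ∀ b ∈ Xt, ∀ a, IsOffspring 𝒬 b a → a ∈ Xt) {b : 𝒳} (hb : b ∈ Xt) :
    ∃ N, ∀ n, N < n → coeff n (progenyGF 𝒬 b) = 0 := by
  obtain ⟨B, hB⟩ := htrans
  let r : {x // x ∈ Xt} → {x // x ∈ Xt} → Prop :=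
    fun x y => Relation.TransGen (IsOffspring 𝒬) y.1 x.1
  have : IsTrans _ r := ⟨fun x y z hxy hyz => Relation.TransGen.trans hyz hxy⟩
  have : Std.Irrefl r := ⟨fun x => hirrefl x.1 x.2⟩
  have hwf : WellFounded r := Finite.wellFounded_of_trans_of_irrefl r
  suffices h : ∀ x : {x // x ∈ Xt}, ∃ N, ∀ n, N < n → coeff n (progenyGF 𝒬 x.1) = 0 from h ⟨b, hb⟩
  intro x
  induction x using hwf.induction with
  | _ x ih =>
    have hex : ∀ y, ∃ N, IsOffspring 𝒬 x.1 y → ∀ n, N < n → coeff n (progenyGF 𝒬 y) = 0 := by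
      intro y
      by_cases hy : IsOffspring 𝒬 x.1 y
      · obtain ⟨N, hN⟩ := ih ⟨y, hclosed x.1 x.2 y hy⟩ (.single hy)
        exact ⟨N, fun _ => hN⟩
      · exact ⟨0, fun h => (hy h).elim⟩
    choose N hN using hex
    obtain ⟨M, hM⟩ := Finite.exists_le N
    refine ⟨M * B + 1, fun n hn => ?_⟩
    obtain ⟨n, rfl⟩ := Nat.exists_eq_succ_of_ne_zero (by omega : n ≠ 0)
    rw [Nat.succ_eq_add_one, coeff_succ_progenyGF, ENNReal.tsum_eq_zero]
    intro c
    by_cases hc : 𝒬 x.1 c = 0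
    · simp [hc]
    · have hlen : c.length ≤ B := by
        refine le_trans (le_of_eq ?_) (hB x.1 c hc)
        rw [eq_comm, List.countP_eq_length]
        exact fun y hy => decide_eq_true (hclosed x.1 x.2 y ⟨c, hc, hy⟩)
      rw [coeff_prod_eq_zero_of_lt (N := M) (fun y hy n hn => hN y ⟨c, hc, hy⟩ n
        ((hM y).trans_lt hn)), mul_zero]
      exact (Nat.mul_le_mul_left M hlen).trans_lt (by omega)

end GeneratingFunctions

/-- A sequence in `(0, 1]` bounded below by `δ ρ ^ n` for every `ρ < 1` decays subexponentially. -/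
theorem tendsto_inv_mul_elog {M : ℕ → ℝ≥0∞} {S : Set ℕ} (h0 : ∀ n ∈ S, M n ≠ 0)
    (h1 : ∀ n, M n ≤ 1)
    (h : ∀ ρ : ℝ≥0∞, ρ ≠ 0 → ρ < 1 → ∃ δ : ℝ≥0∞, δ ≠ 0 ∧ ∃ N, ∀ n ∈ S, N < n → δ * ρ ^ n ≤ M n) :
    Tendsto (fun n : ℕ => (((n : ℝ)⁻¹ : ℝ) : EReal) * elog (M n)) (atTop ⊓ 𝓟 S)
      (nhds (0 : EReal)) := by
  have htop : ∀ n, M n ≠ ∞ := fun n => ((h1 n).trans_lt ENNReal.one_lt_top).ne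
  have heq : (fun n : ℕ => (((n : ℝ)⁻¹ * Real.log (M n).toReal : ℝ) : EReal)) =ᶠ[atTop ⊓ 𝓟 S]
      fun n : ℕ => (((n : ℝ)⁻¹ : ℝ) : EReal) * elog (M n) := by
    refine eventually_inf_principal.2 (.of_forall fun n hn => ?_)
    simp only [elog, if_neg (h0 n hn), if_neg (htop n), EReal.coe_mul]
  refine Tendsto.congr' heq ?_
  rw [← EReal.coe_zero, EReal.tendsto_coe, tendsto_order]
  constructor
  · intro x hx
    obtain ⟨δ, hδ, N, hN⟩ := h (ENNReal.ofReal (Real.exp (x / 2)))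
      (ENNReal.ofReal_pos.2 (Real.exp_pos _)).ne'
      (by rw [ENNReal.ofReal_lt_one, Real.exp_lt_one_iff]; linarith)
    have hd0 : min δ 1 ≠ 0 := by simp [hδ, min_eq_iff]
    have hdpos : 0 < (min δ 1).toReal :=
      ENNReal.toReal_pos hd0 ((min_le_right _ _).trans_lt ENNReal.one_lt_top).ne
    obtain ⟨K, hK⟩ := exists_nat_gt (2 * Real.log (min δ 1).toReal / x)
    refine eventually_inf_principal.2 ?_
    filter_upwards [eventually_gt_atTop N, eventually_gt_atTop K, eventually_gt_atTop 0]
      with n hnN hnK hn0 hnS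
    have hle : min δ 1 * ENNReal.ofReal (Real.exp (x / 2)) ^ n ≤ M n :=
      (by gcongr; exact min_le_left _ _ : _ ≤ δ * _).trans (hN n hnS hnN)
    have hreal := ENNReal.toReal_mono (htop n) hle
    rw [ENNReal.toReal_mul, ENNReal.toReal_pow, ENNReal.toReal_ofReal (Real.exp_nonneg _),
      ← Real.exp_nat_mul] at hreal
    have hlog := Real.log_le_log (by positivity) hreal
    rw [Real.log_mul hdpos.ne' (Real.exp_pos _).ne', Real.log_exp] at hlog
    have hn : (0 : ℝ) < n := by exact_mod_cast hn0
    have hKn : (K : ℝ) < n := by exact_mod_cast hnK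
    rw [div_lt_iff_of_neg hx] at hK
    rw [inv_mul_eq_div, lt_div_iff₀ hn]
    nlinarith
  · intro x hx
    refine .of_forall fun n => lt_of_le_of_lt ?_ hx
    refine mul_nonpos_of_nonneg_of_nonpos (by positivity) (Real.log_nonpos ENNReal.toReal_nonneg ?_)
    rw [← ENNReal.toReal_one]
    exact ENNReal.toReal_mono ENNReal.one_ne_top (h1 n)

section Statement6

variable {𝒳 : Type*} [Fintype 𝒳] [DecidableEq 𝒳]

theorem subexponential_decay_of_size_probability
    (𝒬 : 𝒳 → List 𝒳 → ℝ) (h𝒬_nonneg : ∀ a c, 0 ≤ 𝒬 a c) (h𝒬_sum : ∀ a, HasSum (𝒬 a) 1)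
    (hsecond : ∀ a : 𝒳, Summable (fun c : List 𝒳 => 𝒬 a c * (c.length : ℝ) ^ 2))
    (Xr Xt : Finset 𝒳) (hWI : WeaklyIrred (meanMat 𝒬) Xr Xt)
    (htrans : BoundedTransient 𝒬 Xt)
    (hcrit : CriticalKernel 𝒬)
    (μ0 : 𝒳 → ℝ) (hμ0_nonneg : ∀ a, 0 ≤ μ0 a) (hμ0_sum : ∑ a, μ0 a = 1)
    (hμ0r : 0 < ∑ a ∈ Xr, μ0 a)
    (S : Set ℕ) (hS : S = sizeSupport (mgwWeight μ0 𝒬)) (hSinf : S.Infinite) :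
    Filter.Tendsto
      (fun n : ℕ => (((n : ℝ)⁻¹ : ℝ) : EReal) * elog (treeMass (mgwWeight μ0 𝒬) n))
      (Filter.atTop ⊓ Filter.principal S) (nhds (0 : EReal)) := by
  have hrec : ∀ b ∈ Xr, ∀ a, Relation.TransGen (IsOffspring 𝒬) b a := fun b hb a =>
    (matStar_ne_zero_iff 𝒬 h𝒬_nonneg a b).1 (hWI.rec_pos a b hb).ne'
  have htr : ∀ b ∈ Xt, ∀ a, a = b ∨ a ∈ Xr → ¬ Relation.TransGen (IsOffspring 𝒬) b a :=
    fun b hb a ha hba =>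
      (matStar_ne_zero_iff 𝒬 h𝒬_nonneg a b).2 hba (hWI.trans_zero a b hb ha)
  have hclosed : ∀ a b, IsOffspring 𝒬 b a → a ∈ Xr → b ∈ Xr := fun a b hba ha =>
    (hWI.compl b).2 fun hb => htr b hb a (.inr ha) (.single hba)
  have htclosed : ∀ b ∈ Xt, ∀ a, IsOffspring 𝒬 b a → a ∈ Xt := by
    intro b hb a hba
    by_contra ha
    exact (hWI.compl b).1 (hclosed a b hba ((hWI.compl a).2 ha)) hb
  have hmass := treeMass_mgwWeight μ0 hμ0_nonneg 𝒬 h𝒬_nonneg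
  have hbound : ∀ b, ∃ N, b ∈ Xt → ∀ n, N < n → PowerSeries.coeff n (progenyGF 𝒬 b) = 0 := by
    intro b
    by_cases hb : b ∈ Xt
    · obtain ⟨N, hN⟩ := exists_forall_coeff_eq_zero_of_transient htrans
        (fun b hb => htr b hb b (.inl rfl)) htclosed hb
      exact ⟨N, fun _ => hN⟩
    · exact ⟨0, fun h => (hb h).elim⟩
  choose N hN using hbound
  obtain ⟨K, hK⟩ := Finite.exists_le N
  have hS0 : ∀ n ∈ S, treeMass (mgwWeight μ0 𝒬) n ≠ 0 := fun n hn => by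
    rw [hS] at hn
    exact pos_iff_ne_zero.1 hn
  have hroot : ∀ n ∈ S, K < n → ∃ a ∈ Xr,
      ENNReal.ofReal (μ0 a) * PowerSeries.coeff n (progenyGF 𝒬 a) ≠ 0 := by
    intro n hn hKn
    have h0 := hS0 n hn
    rw [hmass] at h0
    obtain ⟨a, -, ha⟩ := Finset.exists_ne_zero_of_sum_ne_zero h0
    exact ⟨a, (hWI.compl a).2 fun hat =>
      right_ne_zero_of_mul ha (hN a hat n ((hK a).trans_lt hKn)), ha⟩
  have hne : ∀ b, ∃ n, PowerSeries.coeff n (progenyGF 𝒬 b) ≠ 0 := by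
    intro b
    obtain ⟨n, hn, hKn⟩ := hSinf.exists_gt K
    obtain ⟨a, ha, hna⟩ := hroot n hn hKn
    exact progenyGF_ne_zero h𝒬_nonneg h𝒬_sum hsecond hcrit ⟨n, right_ne_zero_of_mul hna⟩
      (hrec a ha b)
  refine tendsto_inv_mul_elog hS0 (fun n => ?_) fun ρ hρ0 hρ => ?_
  · rw [hmass]
    calc _ ≤ ∑ a, ENNReal.ofReal (μ0 a) := Finset.sum_le_sum fun a _ =>
          mul_le_of_le_one_right zero_le (coeff_progenyGF_le_one 𝒬 h𝒬_nonneg h𝒬_sum a n)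
      _ = 1 := by
          rw [← ENNReal.ofReal_sum_of_nonneg fun a _ => hμ0_nonneg a, hμ0_sum, ENNReal.ofReal_one]
  · have hδ : ∀ a, ∃ δ : ℝ≥0∞, δ ≠ 0 ∧ (a ∈ Xr → ∀ n,
        ENNReal.ofReal (μ0 a) * PowerSeries.coeff n (progenyGF 𝒬 a) ≠ 0 →
          δ * ρ ^ n ≤ ENNReal.ofReal (μ0 a) * PowerSeries.coeff n (progenyGF 𝒬 a)) := by
      intro a
      by_cases hμ : ENNReal.ofReal (μ0 a) = 0
      · exact ⟨1, one_ne_zero, fun _ n hn => (left_ne_zero_of_mul hn hμ).elim⟩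
      by_cases ha : a ∈ Xr
      · obtain ⟨δ, hδ0, hδ⟩ := exists_mul_pow_le_coeff h𝒬_nonneg h𝒬_sum hsecond hcrit hrec hclosed
          hne ha hρ0 hρ
        refine ⟨ENNReal.ofReal (μ0 a) * δ, mul_ne_zero hμ hδ0, fun _ n hn => ?_⟩
        rw [mul_assoc]
        gcongr
        exact hδ n (right_ne_zero_of_mul hn)
      · exact ⟨1, one_ne_zero, fun h => (ha h).elim⟩
    choose δ hδ0 hδ using hδ
    refine ⟨Finset.univ.inf δ, ((Finset.lt_inf_iff ENNReal.zero_lt_top).2 fun a _ =>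
      pos_iff_ne_zero.2 (hδ0 a)).ne', K, fun n hn hKn => ?_⟩
    obtain ⟨a, ha, hna⟩ := hroot n hn hKn
    calc _ ≤ δ a * ρ ^ n := by
          gcongr
          exact Finset.inf_le (Finset.mem_univ a)
      _ ≤ _ := hδ a ha n hna
      _ ≤ _ := by
          rw [hmass]
          exact Finset.single_le_sum
            (f := fun a => ENNReal.ofReal (μ0 a) * PowerSeries.coeff n (progenyGF 𝒬 a))
            (fun _ _ => zero_le) (Finset.mem_univ a)

end Statement6
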